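/- Let o.⊙ = closedBall(l_r, τ) ⊆ ℝ², let 𝓡* be a finite family of subsets of ℝ² with l_r ∈ o.⊙ \ ⋃_{r∈𝓡*} r, let r₀ ∈ 𝓡*, set u = connectedComponentIn(o.⊙ \ ⋃_{r∈𝓡*} r, l_r) and d^e = connectedComponentIn(o.⊙ \ r₀, l_r), and for a query range R ⊆ ℝ² set s = (o.⊙ ∩ R) \ ⋃_{r∈𝓡*} r. If s ∩ d^e = ∅, then u ∩ R = ∅; consequently, for every measurable f : ℝ² → [0,∞) vanishing outside u, the appearance probability ∫_{u∩R} f dλ equals 0, i.e., o can be pruned safely. (Lemma 2) -/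

import Mathlib

open MeasureTheory Metric

/-- Lemma 2: if s ∩ d^e = ∅ then o can be pruned safely. -/
theorem stmt_3 {ι : Type*} [Fintype ι] (𝓡star : ι → Set (EuclideanSpace ℝ (Fin 2)))
    (l_r : EuclideanSpace ℝ (Fin 2)) (τ : ℝ) (hτ : 0 < τ)
    (hmem : l_r ∈ closedBall l_r τ \ ⋃ i, 𝓡star i)
    (i₀ : ι) (R : Set (EuclideanSpace ℝ (Fin 2)))
    (u de s : Set (EuclideanSpace ℝ (Fin 2)))
    (hu : u = connectedComponentIn (closedBall l_r τ \ ⋃ i, 𝓡star i) l_r)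
    (hde : de = connectedComponentIn (closedBall l_r τ \ 𝓡star i₀) l_r)
    (hs : s = (closedBall l_r τ ∩ R) \ ⋃ i, 𝓡star i)
    (hempty : s ∩ de = ∅) :
    u ∩ R = ∅ ∧
      ∀ f : EuclideanSpace ℝ (Fin 2) → ℝ, Measurable f → (∀ x, 0 ≤ f x) →
        (∀ x ∉ u, f x = 0) → (∫ x in u ∩ R, f x) = 0 := by
  have huR : u ∩ R = ∅ := by
    refine Set.eq_empty_of_forall_notMem fun x ⟨hxu, hxR⟩ => ?_
    rw [hu] at hxu
    have hx := connectedComponentIn_subset _ _ hxu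
    have hxde : x ∈ de := hde ▸ connectedComponentIn_mono l_r
      (Set.sdiff_subset_sdiff_right (Set.subset_iUnion 𝓡star i₀)) hxu
    have hxs : x ∈ s := hs ▸ ⟨⟨hx.1, hxR⟩, hx.2⟩
    exact hempty.subset ⟨hxs, hxde⟩
  refine ⟨huR, fun f _ _ _ => ?_⟩
  rw [huR, setIntegral_empty]
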